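/- arXiv:1912.02886 — 3 statements merged into one kernel-verified Lean document; each statement's English description precedes it below -/
import Mathlib

section
/- Let p be a real with 0 < p < 1, let ℓ, m be nonnegative integers, and let x ∈ ℝ. Define f(k) = C(ℓ,k) p^k (1−p)^{ℓ−k} for 0 ≤ k ≤ ℓ and g(j) = C(m,j) p^j (1−p)^{m−j} for 0 ≤ j ≤ m. Then for all strictly increasing tuples of reals r_0 < … < r_ℓ and s_0 < … < s_m, Σ_{(k,j) : r_k = s_j + x} f(k) g(j) ≤ max over integers d with −m ≤ d ≤ ℓ of Σ_{(k,j) : 0 ≤ k ≤ ℓ, 0 ≤ j ≤ m, k − j = d} f(k) g(j). Equivalently, the matched-pair sum is at most max_{d ∈ ℤ} D(ℓ, m, p, d). -/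
open Finset

/-- The matched-pair sum `F(r,s) = Σ_{(k,j) : r_k = s_j + x} f(k) g(j)` with
`f(k) = C(ℓ,k) p^k (1-p)^(ℓ-k)` and `g(j) = C(m,j) p^j (1-p)^(m-j)`. -/
noncomputable def F (ℓ m : ℕ) (p x : ℝ) (r s : ℕ → ℝ) : ℝ :=
  ∑ k ∈ Finset.range (ℓ + 1), ∑ j ∈ Finset.range (m + 1),
    if r k = s j + x then
      ((ℓ.choose k : ℝ) * p ^ k * (1 - p) ^ (ℓ - k)) *
        ((m.choose j : ℝ) * p ^ j * (1 - p) ^ (m - j))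
    else 0

/-- `D ℓ m p y` is the probability that `Bin(ℓ,p) - Bin(m,p) = y` for independent
binomials. -/
noncomputable def D (ℓ m : ℕ) (p : ℝ) (y : ℤ) : ℝ :=
  ∑ k ∈ Finset.range (ℓ + 1), ∑ j ∈ Finset.range (m + 1),
    if (k : ℤ) - (j : ℤ) = y then
      (ℓ.choose k : ℝ) * (m.choose j : ℝ) * p ^ (k + j) * (1 - p) ^ ((ℓ - k) + (m - j))
    else 0

/-- The binomial weight `C(n,k) p^k (1-p)^(n-k)`. -/
noncomputable def binomialWeight (n : ℕ) (p : ℝ) (k : ℕ) : ℝ :=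
  (n.choose k : ℝ) * p ^ k * (1 - p) ^ (n - k)

theorem binomialWeight_nonneg (n : ℕ) {p : ℝ} (hp0 : 0 ≤ p) (hp1 : p ≤ 1) (k : ℕ) :
    0 ≤ binomialWeight n p k := by
  have : 0 ≤ 1 - p := sub_nonneg.2 hp1
  unfold binomialWeight
  positivity

theorem binomialWeight_succ_mul {n k : ℕ} (p : ℝ) (hk : k < n) :
    binomialWeight n p (k + 1) * ((k + 1) * (1 - p)) =
      binomialWeight n p k * ((n - k) * p) := by
  have hchoose : (n.choose (k + 1) : ℝ) * (k + 1) = n.choose k * (n - k) := by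
    have h := Nat.choose_succ_right_eq n k
    rw [← Nat.cast_sub hk.le]
    exact_mod_cast h
  have hsub : n - k = n - (k + 1) + 1 := by omega
  unfold binomialWeight
  rw [hsub, pow_succ, pow_succ]
  linear_combination p ^ k * p * (1 - p) ^ (n - (k + 1)) * (1 - p) * hchoose

/-- The binomial weights are unimodal. -/
theorem exists_mode_binomialWeight (n : ℕ) {p : ℝ} (hp0 : 0 < p) (hp1 : p < 1) :
    ∃ a ≤ n, (∀ k < a, binomialWeight n p k ≤ binomialWeight n p (k + 1)) ∧
      ∀ k, a ≤ k → binomialWeight n p (k + 1) ≤ binomialWeight n p k := by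
  have hq : 0 < 1 - p := sub_pos.2 hp1
  have ha : ⌊(n + 1) * p⌋₊ ≤ n := by
    refine Nat.lt_succ_iff.1 ((Nat.floor_lt (by positivity)).2 ?_)
    push_cast
    nlinarith [(Nat.cast_nonneg n : (0 : ℝ) ≤ n)]
  refine ⟨⌊(n + 1) * p⌋₊, ha, fun k hk => ?_, fun k hk => ?_⟩
  · have hle : (k : ℝ) + 1 ≤ (n + 1) * p := by
      have := (Nat.le_floor_iff (by positivity)).1 (Nat.succ_le_of_lt hk)
      exact_mod_cast this
    have hc : (0 : ℝ) < (k + 1) * (1 - p) := by positivity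
    refine le_of_mul_le_mul_right ?_ hc
    rw [binomialWeight_succ_mul p (hk.trans_le ha)]
    refine mul_le_mul_of_nonneg_left ?_ (binomialWeight_nonneg n hp0.le hp1.le k)
    linarith
  · rcases lt_or_ge k n with hkn | hkn
    · have hlt : (n + 1) * p < (k : ℝ) + 1 := by
        have := (Nat.floor_lt (by positivity)).1 (Nat.lt_succ_of_le hk)
        exact_mod_cast this
      have hc : (0 : ℝ) < (k + 1) * (1 - p) := by positivity
      refine le_of_mul_le_mul_right ?_ hc
      rw [binomialWeight_succ_mul p hkn]
      refine mul_le_mul_of_nonneg_left ?_ (binomialWeight_nonneg n hp0.le hp1.le k)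
      linarith
    · have hzero : binomialWeight n p (k + 1) = 0 := by
        simp [binomialWeight, Nat.choose_eq_zero_of_lt (Nat.lt_succ_of_le hkn)]
      rw [hzero]
      exact binomialWeight_nonneg n hp0.le hp1.le k

/-- The position of `k` after the elements of `K` are pushed together around `a`. -/
def compress (K : Finset ℕ) (a k : ℕ) : ℕ :=
  a - #{i ∈ K | i < a} + #{i ∈ K | i < k}

theorem card_filter_lt_le (K : Finset ℕ) (a : ℕ) : #{i ∈ K | i < a} ≤ a := by
  have h : {i ∈ K | i < a} ⊆ range a := fun i hi => mem_range.2 (mem_filter.1 hi).2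
  simpa using card_le_card h

theorem card_filter_lt_le_add (K : Finset ℕ) (a b : ℕ) :
    #{i ∈ K | i < b} ≤ #{i ∈ K | i < a} + (b - a) := by
  have h : {i ∈ K | i < b} ⊆ {i ∈ K | i < a} ∪ Ico a b := by
    intro i hi
    simp only [mem_union, mem_filter, mem_Ico] at hi ⊢
    rcases lt_or_ge i a with h | h
    · exact Or.inl ⟨hi.1, h⟩
    · exact Or.inr ⟨h, hi.2⟩
  calc _ ≤ _ := card_le_card h
    _ ≤ _ := card_union_le _ _
    _ = _ := by rw [Nat.card_Ico]

theorem card_filter_lt_mono (K : Finset ℕ) {a b : ℕ} (hab : a ≤ b) :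
    #{i ∈ K | i < a} ≤ #{i ∈ K | i < b} :=
  card_le_card (monotone_filter_right _ fun _ _ hi => lt_of_lt_of_le hi hab)

theorem compress_mem_Icc_of_le (K : Finset ℕ) {a k : ℕ} (h : a ≤ k) :
    compress K a k ∈ Set.Icc a k := by
  have h1 := card_filter_lt_le K a
  have h2 := card_filter_lt_le_add K a k
  have h3 := card_filter_lt_mono K h
  constructor <;> unfold compress <;> omega

theorem compress_mem_Icc_of_ge (K : Finset ℕ) {a k : ℕ} (h : k ≤ a) :
    compress K a k ∈ Set.Icc k a := by
  have h1 := card_filter_lt_le K a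
  have h2 := card_filter_lt_le_add K k a
  have h3 := card_filter_lt_mono K h
  constructor <;> unfold compress <;> omega

theorem compress_le {K : Finset ℕ} {a k n : ℕ} (ha : a ≤ n) (hk : k ≤ n) :
    compress K a k ≤ n := by
  rcases le_total a k with h | h
  · exact (compress_mem_Icc_of_le K h).2.trans hk
  · exact (compress_mem_Icc_of_ge K h).2.trans ha

/-- Compressing towards the mode of a unimodal sequence does not decrease its values. -/
theorem le_apply_compress {f : ℕ → ℝ} {a : ℕ} (hup : ∀ k < a, f k ≤ f (k + 1))
    (hdown : ∀ k, a ≤ k → f (k + 1) ≤ f k) (K : Finset ℕ) (k : ℕ) :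
    f k ≤ f (compress K a k) := by
  rcases le_total a k with h | h
  · obtain ⟨h1, h2⟩ := compress_mem_Icc_of_le K h
    generalize compress K a k = c at h1 h2
    induction k, h2 using Nat.le_induction with
    | base => exact le_rfl
    | succ k hk ih => exact (hdown k (h1.trans hk)).trans (ih (h1.trans hk))
  · obtain ⟨h1, h2⟩ := compress_mem_Icc_of_ge K h
    generalize compress K a k = c at h1 h2
    induction c, h1 using Nat.le_induction with
    | base => exact le_rfl
    | succ c hc ih => exact (ih (by omega)).trans (hup c (by omega))

/-- For unimodal nonnegative sequences, the weight of an order-preserving matching is at most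
the weight of some diagonal. -/
theorem exists_sum_le_sum_diagonal {f g : ℕ → ℝ} (hf : ∀ k, 0 ≤ f k) (hg : ∀ j, 0 ≤ g j)
    {a b ℓ m : ℕ} (ha : a ≤ ℓ) (hb : b ≤ m)
    (hfup : ∀ k < a, f k ≤ f (k + 1)) (hfdown : ∀ k, a ≤ k → f (k + 1) ≤ f k)
    (hgup : ∀ j < b, g j ≤ g (j + 1)) (hgdown : ∀ j, b ≤ j → g (j + 1) ≤ g j)
    {M : Finset (ℕ × ℕ)} (hM : M ⊆ range (ℓ + 1) ×ˢ range (m + 1))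
    (hchain : ∀ P ∈ M, ∀ Q ∈ M, P.1 < Q.1 ↔ P.2 < Q.2) :
    ∃ d : ℤ, -(m : ℤ) ≤ d ∧ d ≤ (ℓ : ℤ) ∧ ∑ P ∈ M, f P.1 * g P.2 ≤
      ∑ P ∈ range (ℓ + 1) ×ˢ range (m + 1) with (P.1 : ℤ) - P.2 = d, f P.1 * g P.2 := by
  have hfst : Set.InjOn Prod.fst (M : Set (ℕ × ℕ)) := fun P hP Q hQ h => by
    have h1 := hchain P hP Q hQ
    have h2 := hchain Q hQ P hP
    exact Prod.ext h (by omega)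
  have hsnd : Set.InjOn Prod.snd (M : Set (ℕ × ℕ)) := fun P hP Q hQ h => by
    have h1 := hchain P hP Q hQ
    have h2 := hchain Q hQ P hP
    exact Prod.ext (by omega) h
  set K := M.image Prod.fst with hK
  set J := M.image Prod.snd with hJ
  have hcount : ∀ P ∈ M, #{i ∈ K | i < P.1} = #{i ∈ J | i < P.2} := fun P hP => by
    rw [hK, hJ, filter_image, filter_image,
      card_image_of_injOn (hfst.mono (coe_subset.2 (filter_subset _ _))),
      card_image_of_injOn (hsnd.mono (coe_subset.2 (filter_subset _ _)))]
    exact congrArg card (filter_congr fun Q hQ => hchain Q hQ P hP)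
  have hcountlt : ∀ P ∈ M, ∀ Q ∈ M, P.1 < Q.1 → #{i ∈ K | i < P.1} < #{i ∈ K | i < Q.1} :=
    fun P hP Q hQ h => by
      refine card_lt_card (ssubset_iff_of_subset
        (monotone_filter_right _ fun _ _ hi => lt_trans hi h) |>.2 ⟨P.1, ?_, ?_⟩)
      · exact mem_filter.2 ⟨mem_image_of_mem _ hP, h⟩
      · simp
  have hcK := card_filter_lt_le K a
  have hcJ := card_filter_lt_le J b
  let φ : ℕ × ℕ → ℕ × ℕ := fun P => (compress K a P.1, compress J b P.2)
  have hφ : Set.InjOn φ (M : Set (ℕ × ℕ)) := fun P hP Q hQ h => by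
    have h1 : compress K a P.1 = compress K a Q.1 := congrArg Prod.fst h
    unfold compress at h1
    refine hfst hP hQ ?_
    rcases lt_trichotomy P.1 Q.1 with hlt | heq | hlt
    · have := hcountlt P hP Q hQ hlt
      omega
    · exact heq
    · have := hcountlt Q hQ P hP hlt
      omega
  refine ⟨((a - #{i ∈ K | i < a} : ℕ) : ℤ) - ((b - #{i ∈ J | i < b} : ℕ) : ℤ),
    by omega, by omega, ?_⟩
  calc ∑ P ∈ M, f P.1 * g P.2 ≤ ∑ P ∈ M, f (φ P).1 * g (φ P).2 :=
        sum_le_sum fun P _ => mul_le_mul (le_apply_compress hfup hfdown K P.1)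
          (le_apply_compress hgup hgdown J P.2) (hg _) (hf _)
    _ = ∑ P ∈ M.image φ, f P.1 * g P.2 := (sum_image (f := fun P : ℕ × ℕ => f P.1 * g P.2) hφ).symm
    _ ≤ _ := by
        refine sum_le_sum_of_subset_of_nonneg ?_ fun P _ _ => mul_nonneg (hf _) (hg _)
        intro R hR
        obtain ⟨P, hP, rfl⟩ := mem_image.1 hR
        have hPM := mem_product.1 (hM hP)
        simp only [mem_range] at hPM
        have h1 : compress K a P.1 ≤ ℓ := compress_le ha (by omega)
        have h2 : compress J b P.2 ≤ m := compress_le hb (by omega)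
        refine mem_filter.2 ⟨mem_product.2 ⟨mem_range.2 (Nat.lt_succ_of_le h1),
          mem_range.2 (Nat.lt_succ_of_le h2)⟩, ?_⟩
        have h3 := hcount P hP
        simp only [φ, compress]
        omega

theorem F_eq_sum_filter (ℓ m : ℕ) (p x : ℝ) (r s : ℕ → ℝ) :
    F ℓ m p x r s = ∑ P ∈ range (ℓ + 1) ×ˢ range (m + 1) with r P.1 = s P.2 + x,
      binomialWeight ℓ p P.1 * binomialWeight m p P.2 := by
  rw [sum_filter, sum_product]
  rfl

theorem D_eq_sum_filter (ℓ m : ℕ) (p : ℝ) (d : ℤ) :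
    D ℓ m p d = ∑ P ∈ range (ℓ + 1) ×ˢ range (m + 1) with (P.1 : ℤ) - P.2 = d,
      binomialWeight ℓ p P.1 * binomialWeight m p P.2 := by
  rw [sum_filter, sum_product]
  refine sum_congr rfl fun k _ => sum_congr rfl fun j _ => ?_
  congr 1
  simp only [binomialWeight, pow_add]
  ring

theorem lt_iff_lt_of_lt_succ {r : ℕ → ℝ} {n : ℕ} (hr : ∀ k, k < n → r k < r (k + 1))
    {i j : ℕ} (hi : i ≤ n) (hj : j ≤ n) : r i < r j ↔ i < j := by
  have hmono : StrictMonoOn r (Set.Iic n) :=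
    strictMonoOn_of_lt_succ Set.ordConnected_Iic fun k _ _ hk => by
      rw [Nat.succ_eq_succ] at hk ⊢
      exact hr k (Nat.lt_of_succ_le hk)
  exact hmono.lt_iff_lt hi hj

/-- for every pair of strictly increasing tuples, the matched-pair sum
is at most the maximum of `D(ℓ, m, p, d)` over `-m ≤ d ≤ ℓ`. -/
theorem stmt_6 (p : ℝ) (hp0 : 0 < p) (hp1 : p < 1) (ℓ m : ℕ) (x : ℝ)
    (r s : ℕ → ℝ)
    (hr : ∀ k, k < ℓ → r k < r (k + 1)) (hs : ∀ j, j < m → s j < s (j + 1)) :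
    ∃ d : ℤ, -(m : ℤ) ≤ d ∧ d ≤ (ℓ : ℤ) ∧ F ℓ m p x r s ≤ D ℓ m p d := by
  obtain ⟨a, ha, hfup, hfdown⟩ := exists_mode_binomialWeight ℓ hp0 hp1
  obtain ⟨b, hb, hgup, hgdown⟩ := exists_mode_binomialWeight m hp0 hp1
  simp only [F_eq_sum_filter, D_eq_sum_filter]
  refine exists_sum_le_sum_diagonal (binomialWeight_nonneg ℓ hp0.le hp1.le)
    (binomialWeight_nonneg m hp0.le hp1.le) ha hb hfup hfdown hgup hgdown
    (filter_subset _ _) fun P hP Q hQ => ?_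
  simp only [mem_filter, mem_product, mem_range, Nat.lt_succ_iff] at hP hQ
  rw [← lt_iff_lt_of_lt_succ hr hP.1.1 hQ.1.1, ← lt_iff_lt_of_lt_succ hs hP.1.2 hQ.1.2,
    hP.2, hQ.2, add_lt_add_iff_right]
end

section
/- Let n be a positive integer and let p be a real with 0 ≤ p ≤ 1. Then for every integer ℓ with 0 ≤ ℓ ≤ n, D(ℓ, n−ℓ, p, 0) ≤ D(⌈n/2⌉, ⌊n/2⌋, p, 0). Equivalently, Σ_{k ≥ 0} p^{2k} (1−p)^{n−2k} C(ℓ,k) C(n−ℓ,k) ≤ Σ_{k ≥ 0} p^{2k} (1−p)^{n−2k} C(⌈n/2⌉,k) C(⌊n/2⌋,k); that is, the probability that Bin(ℓ,p) − Bin(n−ℓ,p) = 0 is maximized over ℓ at ℓ = ⌈n/2⌉, for every p. -/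
open Finset

theorem choose_succ_mul_choose_le (a m k : ℕ) (h : m ≤ a) :
    (a + 1).choose k * m.choose k ≤ a.choose k * (m + 1).choose k := by
  rcases lt_or_ge m k with hk | hk
  · simp [Nat.choose_eq_zero_of_lt hk]
  obtain ⟨x, rfl⟩ := Nat.exists_eq_add_of_le hk
  obtain ⟨y, rfl⟩ := Nat.exists_eq_add_of_le h
  have h1 := Nat.choose_mul_succ_eq (k + x + y) k
  have h2 := Nat.choose_mul_succ_eq (k + x) k
  rw [show k + x + y + 1 - k = x + y + 1 by omega] at h1
  rw [show k + x + 1 - k = x + 1 by omega] at h2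
  refine Nat.le_of_mul_le_mul_right (c := (x + y + 1) * (x + 1)) ?_ (by positivity)
  calc _ = ((k + x + y + 1).choose k * (x + y + 1)) * ((k + x).choose k * (x + 1)) := by ring
    _ = ((k + x + y).choose k * (k + x).choose k) * ((k + x + y + 1) * (x + 1)) := by
      rw [← h1]; ring
    _ ≤ ((k + x + y).choose k * (k + x).choose k) * ((x + y + 1) * (k + x + 1)) := by
      refine Nat.mul_le_mul_left _ ?_
      nlinarith [Nat.zero_le (k * y)]
    _ = ((k + x + y).choose k * (x + y + 1)) * ((k + x).choose k * (k + x + 1)) := by ring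
    _ = _ := by rw [h2]; ring

theorem choose_add_mul_choose_le (a d m k : ℕ) (h : m ≤ a) :
    (a + d).choose k * m.choose k ≤ a.choose k * (m + d).choose k := by
  induction d generalizing m with
  | zero => simp
  | succ d ih =>
    rcases h.eq_or_lt with rfl | h
    · rw [mul_comm]
    · refine (choose_succ_mul_choose_le (a + d) m k (by omega)).trans ?_
      simpa [Nat.add_assoc, Nat.add_comm 1 d] using ih (m + 1) h

theorem choose_mul_choose_sub_le (n ℓ k : ℕ) (h : ℓ ≤ n) :
    ℓ.choose k * (n - ℓ).choose k ≤ ((n + 1) / 2).choose k * (n / 2).choose k := by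
  rcases le_or_gt ((n + 1) / 2) ℓ with hl | hl
  · have := choose_add_mul_choose_le ((n + 1) / 2) (ℓ - (n + 1) / 2) (n - ℓ) k (by omega)
    rwa [show (n + 1) / 2 + (ℓ - (n + 1) / 2) = ℓ by omega,
      show n - ℓ + (ℓ - (n + 1) / 2) = n / 2 by omega] at this
  · have := choose_add_mul_choose_le ((n + 1) / 2) (n / 2 - ℓ) ℓ k (by omega)
    rwa [show (n + 1) / 2 + (n / 2 - ℓ) = n - ℓ by omega,
      show ℓ + (n / 2 - ℓ) = n / 2 by omega, mul_comm] at this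

theorem D_zero_eq_sum (ℓ m : ℕ) (p : ℝ) :
    D ℓ m p 0 = ∑ k ∈ Finset.range (ℓ + m + 1),
      ((ℓ.choose k * m.choose k : ℕ) : ℝ) * (p ^ (2 * k) * (1 - p) ^ (ℓ + m - 2 * k)) := by
  rw [← Finset.sum_subset (Finset.range_mono (by omega : ℓ + 1 ≤ ℓ + m + 1))]
  · refine Finset.sum_congr rfl fun k hk => ?_
    simp only [sub_eq_zero, Nat.cast_inj, Finset.sum_ite_eq, Finset.mem_range] at hk ⊢
    split_ifs with hm
    · rw [show ℓ + m - 2 * k = (ℓ - k) + (m - k) by omega, two_mul]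
      push_cast
      ring
    · simp [Nat.choose_eq_zero_of_lt (by omega : m < k)]
  · intro k _ hk
    rw [Finset.mem_range] at hk
    simp [Nat.choose_eq_zero_of_lt (by omega : ℓ < k)]

/-- for every `p`, the probability that `Bin(ℓ,p) - Bin(n-ℓ,p) = 0`
is maximized over `ℓ` at `ℓ = ⌈n/2⌉`. -/
theorem stmt_10 (n : ℕ) (hn : 0 < n) (p : ℝ) (hp0 : 0 ≤ p) (hp1 : p ≤ 1)
    (ℓ : ℕ) (hℓ : ℓ ≤ n) :
    D ℓ (n - ℓ) p 0 ≤ D ((n + 1) / 2) (n / 2) p 0 := by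
  rw [D_zero_eq_sum, D_zero_eq_sum, show ℓ + (n - ℓ) = n by omega,
    show (n + 1) / 2 + n / 2 = n by omega]
  have hq : 0 ≤ 1 - p := sub_nonneg.2 hp1
  refine Finset.sum_le_sum fun k _ => mul_le_mul_of_nonneg_right ?_ (by positivity)
  exact_mod_cast choose_mul_choose_sub_le n ℓ k hℓ
end

section
/- Let r and s be coprime positive integers with s odd and r < s, and set p = r/s (so 0 < p < 1). Then there exists N such that for every odd integer n ≥ N, for every integer ℓ with 0 ≤ ℓ ≤ n and every integer y, D(ℓ, n−ℓ, p, y) ≤ D((n+s)/2, (n−s)/2, p, r). That is, for sufficiently large odd n the concentration probability over ±1 signings is maximized by taking (n+s)/2 coefficients equal to 1, at the point x = r. -/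
open Finset

open Real intervalIntegral in
/-- Lower bound for `∫₀^π f` from a window `[a, b]` where `f` is large and constant error bounds
elsewhere. -/
theorem le_integral_of_window {f : ℝ → ℝ} (hf : Continuous f) {a b T e₀ e₁ m : ℝ}
    (ha : 0 ≤ a) (hab : a ≤ b) (hbT : b ≤ T) (hT : T ≤ π) (he₁ : 0 ≤ e₁)
    (h₀ : ∀ t ∈ Set.Icc 0 T, -e₀ ≤ f t) (hm : ∀ t ∈ Set.Icc a b, m - e₀ ≤ f t)
    (h₁ : ∀ t ∈ Set.Icc T π, -e₁ ≤ f t) :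
    (b - a) * m - T * e₀ - π * e₁ ≤ ∫ t in (0 : ℝ)..π, f t := by
  have hi : ∀ u v, IntervalIntegrable f MeasureTheory.volume u v :=
    fun u v => hf.intervalIntegrable u v
  have key : ∀ {u v k : ℝ}, u ≤ v → (∀ t ∈ Set.Icc u v, k ≤ f t) →
      (v - u) * k ≤ ∫ t in u..v, f t := by
    intro u v k huv hk
    have := integral_mono_on huv (intervalIntegrable_const (c := k)) (hi u v) hk
    simpa using this
  have i₁ := key ha fun t ht => h₀ t ⟨ht.1, by linarith [ht.2]⟩
  have i₂ := key hab hm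
  have i₃ := key hbT fun t ht => h₀ t ⟨by linarith [ht.1], ht.2⟩
  have i₄ := key hT h₁
  rw [← integral_add_adjacent_intervals (hi 0 a) (hi a π),
    ← integral_add_adjacent_intervals (hi a b) (hi b π),
    ← integral_add_adjacent_intervals (hi b T) (hi T π)]
  nlinarith

theorem sq_div_five_le_one_sub_cos {u : ℝ} (hu : |u| ≤ 1) : u ^ 2 / 5 ≤ 1 - Real.cos u := by
  have hpi := Real.pi_gt_three
  have hpi' := Real.pi_lt_d2
  have h := Real.cos_le_one_sub_mul_cos_sq (x := u) (by linarith)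
  have h5 : (1 : ℝ) / 5 ≤ 2 / Real.pi ^ 2 := by
    rw [div_le_div_iff₀ (by norm_num) (by positivity)]
    nlinarith
  nlinarith [mul_le_mul_of_nonneg_right h5 (sq_nonneg u)]

theorem one_sub_cos_le_sq_div_two (u : ℝ) : 1 - Real.cos u ≤ u ^ 2 / 2 := by
  linarith [Real.one_sub_sq_div_two_le_cos (x := u)]

theorem exp_neg_le_factorial_div_pow {u : ℝ} (hu : 0 < u) (k : ℕ) :
    Real.exp (-u) ≤ k.factorial / u ^ k := by
  have h := Real.pow_div_factorial_le_exp u hu.le k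
  rw [Real.exp_neg, ← inv_div]
  exact inv_anti₀ (by positivity) h

/-- A log-modulus `ρ` that is quadratic at the origin together with a phase `ψ` that is cubic at
the origin. -/
structure PhaseBounds (ρ ψ : ℝ → ℝ) (c C c₁ c₂ : ℝ) : Prop where
  continuous_modulus : Continuous ρ
  continuous_phase : Continuous ψ
  c_pos : 0 < c
  c₁_pos : 0 < c₁
  c₂_pos : 0 < c₂
  C_pos : 0 < C
  modulus_le : ∀ t ∈ Set.Icc 0 Real.pi, ρ t ≤ -(c * t ^ 2)
  le_modulus : ∀ t ∈ Set.Icc 0 Real.pi, -(C * t ^ 2) ≤ ρ t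
  phase_le : ∀ t ∈ Set.Icc 0 Real.pi, |ψ t| ≤ c₂ * t ^ 3
  le_phase : ∀ t ∈ Set.Icc 0 Real.pi, c₁ * t ^ 3 ≤ |ψ t|

namespace PhaseBounds

variable {ρ ψ : ℝ → ℝ} {c C c₁ c₂ : ℝ}

theorem exp_tail_le (H : PhaseBounds ρ ψ c C c₁ c₂) {b x t : ℝ} (hb : 0 < b) (hx : 0 < x)
    (hbt : b / x ^ 2 ≤ t) (ht : t ≤ Real.pi) :
    Real.exp (x ^ 6 * ρ t) ≤ ((12).factorial / (c * b ^ 2) ^ 12) / x ^ 24 := by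
  have hc := H.c_pos
  have ht0 : 0 ≤ t := le_trans (by positivity) hbt
  have h1 : x ^ 6 * ρ t ≤ -(c * b ^ 2 * x ^ 2) := by
    have h2 := mul_le_mul_of_nonneg_left (H.modulus_le t ⟨ht0, ht⟩) (pow_pos hx 6).le
    have h3 : (b / x ^ 2) ^ 2 ≤ t ^ 2 := by gcongr
    have h4 : c * b ^ 2 * x ^ 2 = x ^ 6 * (c * (b / x ^ 2) ^ 2) := by field_simp
    have h5 : x ^ 6 * (c * (b / x ^ 2) ^ 2) ≤ x ^ 6 * (c * t ^ 2) := by gcongr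
    linarith
  calc Real.exp (x ^ 6 * ρ t) ≤ Real.exp (-(c * b ^ 2 * x ^ 2)) := Real.exp_le_exp.2 h1
    _ ≤ (12).factorial / (c * b ^ 2 * x ^ 2) ^ 12 :=
        exp_neg_le_factorial_div_pow (by positivity) 12
    _ = _ := by rw [div_div, mul_pow (c * b ^ 2), ← pow_mul]

theorem pow_six_mul_exp_le (H : PhaseBounds ρ ψ c C c₁ c₂) {x t : ℝ} (hx : 0 < x)
    (ht : t ∈ Set.Icc 0 Real.pi) : t ^ 6 * Real.exp (x ^ 6 * ρ t) ≤ 6 / c ^ 3 / x ^ 18 := by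
  have hc := H.c_pos
  rcases ht.1.eq_or_lt with h0 | h0
  · rw [← h0]; simp only [ne_eq, OfNat.ofNat_ne_zero, not_false_eq_true, zero_pow, zero_mul]
    positivity
  have h1 : x ^ 6 * ρ t ≤ -(c * x ^ 6 * t ^ 2) := by
    have h2 := mul_le_mul_of_nonneg_left (H.modulus_le t ht) (pow_pos hx 6).le
    linarith
  have h2 := exp_neg_le_factorial_div_pow (u := c * x ^ 6 * t ^ 2) (by positivity) 3
  calc t ^ 6 * Real.exp (x ^ 6 * ρ t) ≤ t ^ 6 * (Nat.factorial 3 / (c * x ^ 6 * t ^ 2) ^ 3) := by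
        gcongr; exact (Real.exp_le_exp.2 h1).trans h2
    _ = _ := by
        simp only [Nat.factorial]; push_cast; field_simp

theorem exp_neg_le_exp (H : PhaseBounds ρ ψ c C c₁ c₂) {x t : ℝ} (hx : 0 ≤ x)
    (ht : t ∈ Set.Icc 0 Real.pi) (hxt : x ^ 6 * t ^ 2 ≤ 1) :
    Real.exp (-C) ≤ Real.exp (x ^ 6 * ρ t) := by
  have hC := H.C_pos
  have h2 := mul_le_mul_of_nonneg_left (H.le_modulus t ht) (pow_nonneg hx 6)
  apply Real.exp_le_exp.2
  nlinarith

theorem neg_two_mul_le (a u v : ℝ) (ha : 0 ≤ a) : -(2 * a) ≤ a * (Real.cos u - Real.cos v) := by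
  nlinarith [Real.neg_one_le_cos u, Real.cos_le_one v]

/-- A linear term in the phase costs more than a bounded multiple of the cubic phase. -/
theorem integral_le_of_linear_term (H : PhaseBounds ρ ψ c C c₁ c₂) {s : ℝ} (hs : 0 < s) :
    ∃ X : ℝ, ∀ x : ℝ, X ≤ x → ∀ d δ : ℝ, |d| ≤ x ^ 6 → 1 / s ≤ |δ| → |δ| ≤ 2 * x ^ 6 →
      ∫ t in (0 : ℝ)..Real.pi, Real.exp (x ^ 6 * ρ t) * Real.cos (d * ψ t - δ * t) ≤
        ∫ t in (0 : ℝ)..Real.pi, Real.exp (x ^ 6 * ρ t) * Real.cos (s * ψ t) := by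
  have hc := H.c_pos
  have hc₂ := H.c₂_pos
  have hρ := H.continuous_modulus
  have hψ := H.continuous_phase
  have hpi := Real.pi_gt_three
  set K := s ^ 2 * c₂ ^ 2 / 2 * (6 / c ^ 3) with hK
  set L : ℝ := 2 * ((12).factorial / (c * 1 ^ 2) ^ 12) with hL
  set k := Real.exp (-C) / (8 * 1280 * s ^ 2) with hk
  have hKpos : 0 < K := by positivity
  have hLpos : 0 < L := by positivity
  have hkpos : 0 < k := by positivity
  refine ⟨1 + s * c₂ + (K + Real.pi * L) / k, fun x hx d δ hd hδ hδ' => ?_⟩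
  have hx1 : 1 ≤ x := by
    have : 0 ≤ s * c₂ + (K + Real.pi * L) / k := by positivity
    linarith
  have hx2 : s * c₂ ≤ x := by
    have : 0 ≤ 1 + (K + Real.pi * L) / k := by positivity
    linarith
  have hx3 : K + Real.pi * L ≤ k * x := by
    have : (K + Real.pi * L) / k ≤ x := by
      have : 0 ≤ 1 + s * c₂ := by positivity
      linarith
    rwa [div_le_iff₀' hkpos] at this
  have hx0 : 0 < x := by linarith
  have hx6 : 1 ≤ x ^ 6 := one_le_pow₀ hx1
  have hxx6 : x ≤ x ^ 6 := by
    calc x = x ^ 1 := (pow_one x).symm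
      _ ≤ x ^ 6 := pow_le_pow_right₀ hx1 (by norm_num)
  have hx26 : x ^ 2 ≤ x ^ 6 := pow_le_pow_right₀ hx1 (by norm_num)
  have hT1 : 1 / x ^ 2 ≤ (1 : ℝ) := by
    rw [div_le_one (by positivity)]; exact one_le_pow₀ hx1
  rw [← sub_nonneg, ← intervalIntegral.integral_sub
    (by apply Continuous.intervalIntegrable; fun_prop)
    (by apply Continuous.intervalIntegrable; fun_prop)]
  have hloss : ∀ t ∈ Set.Icc 0 (1 / x ^ 2),
      Real.exp (x ^ 6 * ρ t) * (1 - Real.cos (s * ψ t)) ≤ K / x ^ 18 := by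
    intro t ht
    have ht' : t ∈ Set.Icc 0 Real.pi := ⟨ht.1, by linarith [ht.2]⟩
    have hsq : ψ t ^ 2 ≤ (c₂ * t ^ 3) ^ 2 := by
      rw [← sq_abs]; exact pow_le_pow_left₀ (abs_nonneg _) (H.phase_le t ht') 2
    calc Real.exp (x ^ 6 * ρ t) * (1 - Real.cos (s * ψ t))
        ≤ Real.exp (x ^ 6 * ρ t) * ((s * ψ t) ^ 2 / 2) := by
          gcongr; exact one_sub_cos_le_sq_div_two _
      _ = s ^ 2 / 2 * Real.exp (x ^ 6 * ρ t) * ψ t ^ 2 := by ring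
      _ ≤ s ^ 2 / 2 * Real.exp (x ^ 6 * ρ t) * (c₂ * t ^ 3) ^ 2 := by gcongr
      _ = s ^ 2 * c₂ ^ 2 / 2 * (t ^ 6 * Real.exp (x ^ 6 * ρ t)) := by ring
      _ ≤ s ^ 2 * c₂ ^ 2 / 2 * (6 / c ^ 3 / x ^ 18) := by
          gcongr; exact H.pow_six_mul_exp_le hx0 ht'
      _ = K / x ^ 18 := by rw [hK]; ring
  have hwin := le_integral_of_window
    (f := fun t => Real.exp (x ^ 6 * ρ t) * Real.cos (s * ψ t) -
      Real.exp (x ^ 6 * ρ t) * Real.cos (d * ψ t - δ * t))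
    (by fun_prop) (a := 1 / (8 * x ^ 6)) (b := 1 / (4 * x ^ 6)) (T := 1 / x ^ 2)
    (e₀ := K / x ^ 18) (e₁ := L / x ^ 24) (m := Real.exp (-C) / (1280 * s ^ 2) / x ^ 12)
    (by positivity) (by gcongr; norm_num) (by gcongr; linarith) (by linarith) (by positivity)
    ?_ ?_ ?_
  · refine le_trans ?_ hwin
    have e : (1 / (4 * x ^ 6) - 1 / (8 * x ^ 6)) * (Real.exp (-C) / (1280 * s ^ 2) / x ^ 12) -
        1 / x ^ 2 * (K / x ^ 18) - Real.pi * (L / x ^ 24) =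
        (k * x ^ 6 - K * x ^ 4 - Real.pi * L) / x ^ 24 := by
      rw [hk]; field_simp; ring
    rw [e]
    apply div_nonneg _ (by positivity)
    have h1 : (K + Real.pi * L) * x ^ 5 ≤ k * x * x ^ 5 := by gcongr
    have h2 : K * x ^ 4 ≤ K * x ^ 5 := by gcongr; norm_num
    have h3 : Real.pi * L * 1 ≤ Real.pi * L * x ^ 5 := by
      gcongr; exact one_le_pow₀ hx1
    linarith
  · intro t ht
    have h1 := hloss t ht
    have h2 : 0 ≤ Real.exp (x ^ 6 * ρ t) * (1 - Real.cos (d * ψ t - δ * t)) :=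
      mul_nonneg (Real.exp_pos _).le (by linarith [Real.cos_le_one (d * ψ t - δ * t)])
    linarith
  · intro t ht
    have ht0 : 0 < t := lt_of_lt_of_le (by positivity) ht.1
    have htx : x ^ 6 * t ≤ 1 / 4 := by
      calc x ^ 6 * t ≤ x ^ 6 * (1 / (4 * x ^ 6)) := by gcongr; exact ht.2
        _ = 1 / 4 := by field_simp
    have htx' : 1 / 8 ≤ x ^ 6 * t := by
      calc 1 / 8 = x ^ 6 * (1 / (8 * x ^ 6)) := by field_simp
        _ ≤ x ^ 6 * t := by gcongr; exact ht.1
    have ht4 : t ≤ 1 / 4 := by nlinarith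
    have h1 := hloss t ⟨ht0.le, ht.2.trans (by gcongr; linarith)⟩
    have ht' : t ∈ Set.Icc 0 Real.pi := ⟨ht0.le, by linarith⟩
    have hdψ : |d * ψ t| ≤ t / (2 * s) := by
      rw [abs_mul, le_div_iff₀ (by positivity)]
      calc |d| * |ψ t| * (2 * s) ≤ x ^ 6 * (c₂ * t ^ 3) * (2 * s) := by
            gcongr; exact H.phase_le t ht'
        _ = 2 * (x ^ 6 * t) * (s * c₂ * t) * t := by ring
        _ ≤ 2 * (1 / 4) * (x ^ 6 * t) * t := by gcongr; exact hx2.trans hxx6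
        _ ≤ 2 * (1 / 4) * (1 / 4) * t := by gcongr
        _ ≤ t := by linarith
    have hδt : t / s ≤ |δ * t| := by
      rw [abs_mul, abs_of_pos ht0]
      calc t / s = 1 / s * t := by ring
        _ ≤ |δ| * t := by gcongr
    have hδt' : |δ * t| ≤ 1 / 2 := by
      rw [abs_mul, abs_of_pos ht0]
      calc |δ| * t ≤ 2 * x ^ 6 * t := by gcongr
        _ ≤ 1 / 2 := by linarith
    have hhalf : t / (2 * s) = t / s / 2 := by field_simp
    have hu1 : |d * ψ t - δ * t| ≤ 1 := by
      have := abs_sub (d * ψ t) (δ * t)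
      linarith
    have hu2 : t / (2 * s) ≤ |d * ψ t - δ * t| := by
      have := abs_sub_abs_le_abs_sub (δ * t) (d * ψ t)
      rw [abs_sub_comm] at this
      linarith
    have hu3 : 1 / (1280 * s ^ 2) / x ^ 12 ≤ 1 - Real.cos (d * ψ t - δ * t) := by
      refine le_trans ?_ (sq_div_five_le_one_sub_cos hu1)
      rw [← sq_abs (d * ψ t - δ * t)]
      have h8 : 1 / (16 * s * x ^ 6) ≤ |d * ψ t - δ * t| := by
        refine le_trans ?_ hu2
        rw [div_le_div_iff₀ (by positivity) (by positivity)]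
        nlinarith
      calc 1 / (1280 * s ^ 2) / x ^ 12 = (1 / (16 * s * x ^ 6)) ^ 2 / 5 := by field_simp; norm_num
        _ ≤ _ := by gcongr
    have hA := H.exp_neg_le_exp hx0.le ht' (by nlinarith)
    have h9 : Real.exp (-C) / (1280 * s ^ 2) / x ^ 12 ≤
        Real.exp (x ^ 6 * ρ t) * (1 - Real.cos (d * ψ t - δ * t)) := by
      calc Real.exp (-C) / (1280 * s ^ 2) / x ^ 12
          = Real.exp (-C) * (1 / (1280 * s ^ 2) / x ^ 12) := by ring
        _ ≤ _ := by gcongr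
    linarith
  · intro t ht
    have h1 := H.exp_tail_le one_pos hx0 ht.1 ht.2
    have h2 := neg_two_mul_le (Real.exp (x ^ 6 * ρ t)) (s * ψ t) (d * ψ t - δ * t)
      (Real.exp_pos _).le
    have h3 : L / x ^ 24 = 2 * ((12).factorial / (c * 1 ^ 2) ^ 12 / x ^ 24) := by rw [hL]; ring
    rw [h3]
    linarith

/-- Tripling the cubic phase decreases the oscillatory integral. -/
theorem integral_le_of_three_mul_le (H : PhaseBounds ρ ψ c C c₁ c₂) {s : ℝ} (hs : 0 < s) :
    ∃ X : ℝ, ∀ x : ℝ, X ≤ x → ∀ d : ℝ, |d| ≤ x ^ 6 → 3 * s ≤ |d| →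
      ∫ t in (0 : ℝ)..Real.pi, Real.exp (x ^ 6 * ρ t) * Real.cos (d * ψ t) ≤
        ∫ t in (0 : ℝ)..Real.pi, Real.exp (x ^ 6 * ρ t) * Real.cos (s * ψ t) := by
  have hc := H.c_pos
  have hc₁ := H.c₁_pos
  have hc₂ := H.c₂_pos
  have hρ := H.continuous_modulus
  have hψ := H.continuous_phase
  have hpi := Real.pi_gt_three
  set b := 1 / (1 + c₂) with hb
  have hbpos : 0 < b := by positivity
  have hb1 : b ≤ 1 := by rw [hb, div_le_one (by positivity)]; linarith
  have hbc : c₂ * b ≤ 1 := by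
    rw [hb, mul_one_div, div_le_one (by positivity)]; linarith
  set L : ℝ := 2 * ((12).factorial / (c * b ^ 2) ^ 12) with hL
  set k := Real.exp (-C) * (s ^ 2 * c₁ ^ 2 / 64) / 2 with hk
  have hLpos : 0 < L := by positivity
  have hkpos : 0 < k := by positivity
  refine ⟨1 + 1 / b + Real.pi * L / k, fun x hx d hd hsd => ?_⟩
  have hx1 : 1 ≤ x := by
    have : 0 ≤ 1 / b + Real.pi * L / k := by positivity
    linarith
  have hx2 : 1 ≤ b * x := by
    have : 1 / b ≤ x := by
      have : 0 ≤ 1 + Real.pi * L / k := by positivity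
      linarith
    rwa [div_le_iff₀' hbpos] at this
  have hx3 : Real.pi * L ≤ k * x := by
    have : Real.pi * L / k ≤ x := by
      have : 0 ≤ 1 + 1 / b := by positivity
      linarith
    rwa [div_le_iff₀' hkpos] at this
  have hx0 : 0 < x := by linarith
  have hT1 : b / x ^ 2 ≤ (1 : ℝ) := by
    rw [div_le_one (by positivity)]; exact hb1.trans (one_le_pow₀ hx1)
  have hwT : 1 / x ^ 3 ≤ b / x ^ 2 := by
    rw [div_le_div_iff₀ (by positivity) (by positivity)]
    nlinarith [pow_pos hx0 2]
  rw [← sub_nonneg, ← intervalIntegral.integral_sub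
    (by apply Continuous.intervalIntegrable; fun_prop)
    (by apply Continuous.intervalIntegrable; fun_prop)]
  have hgain : ∀ t ∈ Set.Icc 0 (b / x ^ 2), Real.exp (x ^ 6 * ρ t) * (s * ψ t) ^ 2 ≤
      Real.exp (x ^ 6 * ρ t) * Real.cos (s * ψ t) -
      Real.exp (x ^ 6 * ρ t) * Real.cos (d * ψ t) := by
    intro t ht
    have ht' : t ∈ Set.Icc 0 Real.pi := ⟨ht.1, by linarith [ht.2]⟩
    have hu : |d * ψ t| ≤ 1 := by
      rw [abs_mul]
      have ht0 := ht.1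
      calc |d| * |ψ t| ≤ x ^ 6 * (c₂ * t ^ 3) := by
            gcongr; exact H.phase_le t ht'
        _ ≤ x ^ 6 * (c₂ * (b / x ^ 2) ^ 3) := by gcongr; exact ht.2
        _ = (c₂ * b) * b ^ 2 := by field_simp
        _ ≤ 1 * 1 ^ 2 := by gcongr
        _ = 1 := by norm_num
    have h1 := sq_div_five_le_one_sub_cos hu
    have h2 := one_sub_cos_le_sq_div_two (s * ψ t)
    have h3 : (3 * s) ^ 2 ≤ d ^ 2 := by
      rw [← sq_abs d]; gcongr
    have h4 : 9 * (s * ψ t) ^ 2 ≤ (d * ψ t) ^ 2 := by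
      have := mul_le_mul_of_nonneg_right h3 (sq_nonneg (ψ t))
      linarith
    rw [← mul_sub]
    gcongr
    nlinarith [sq_nonneg (s * ψ t)]
  have hwin := le_integral_of_window
    (f := fun t => Real.exp (x ^ 6 * ρ t) * Real.cos (s * ψ t) -
      Real.exp (x ^ 6 * ρ t) * Real.cos (d * ψ t))
    (by fun_prop) (a := 1 / (2 * x ^ 3)) (b := 1 / x ^ 3) (T := b / x ^ 2)
    (e₀ := 0) (e₁ := L / x ^ 24) (m := Real.exp (-C) * (s ^ 2 * c₁ ^ 2 / 64) / x ^ 18)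
    (by positivity) (by gcongr; linarith [pow_pos hx0 3]) hwT (by linarith) (by positivity)
    ?_ ?_ ?_
  · refine le_trans ?_ hwin
    have e : (1 / x ^ 3 - 1 / (2 * x ^ 3)) *
        (Real.exp (-C) * (s ^ 2 * c₁ ^ 2 / 64) / x ^ 18) -
        b / x ^ 2 * 0 - Real.pi * (L / x ^ 24) =
        (k * x ^ 3 - Real.pi * L) / x ^ 24 := by
      rw [hk]; field_simp; ring
    rw [e]
    apply div_nonneg _ (by positivity)
    have h1 : k * x ≤ k * x ^ 3 := by
      gcongr
      calc x = x ^ 1 := (pow_one x).symm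
        _ ≤ x ^ 3 := pow_le_pow_right₀ hx1 (by norm_num)
    linarith
  · intro t ht
    have h1 := hgain t ht
    have h2 : 0 ≤ Real.exp (x ^ 6 * ρ t) * (s * ψ t) ^ 2 := by positivity
    linarith
  · intro t ht
    have ht0 : 0 < t := lt_of_lt_of_le (by positivity) ht.1
    have h1 := hgain t ⟨ht0.le, ht.2.trans hwT⟩
    have ht' : t ∈ Set.Icc 0 Real.pi := ⟨ht0.le, by linarith [ht.2]⟩
    have htx : x ^ 3 * t ≤ 1 := by
      calc x ^ 3 * t ≤ x ^ 3 * (1 / x ^ 3) := by gcongr; exact ht.2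
        _ = 1 := by field_simp
    have hA := H.exp_neg_le_exp hx0.le ht' (by
      calc x ^ 6 * t ^ 2 = (x ^ 3 * t) ^ 2 := by ring
        _ ≤ 1 := pow_le_one₀ (by positivity) htx)
    have hψ' : s * (c₁ * (1 / (2 * x ^ 3)) ^ 3) ≤ s * |ψ t| := by
      gcongr
      refine le_trans ?_ (H.le_phase t ht')
      gcongr
      exact ht.1
    have h9 : Real.exp (-C) * (s ^ 2 * c₁ ^ 2 / 64) / x ^ 18 ≤
        Real.exp (x ^ 6 * ρ t) * (s * ψ t) ^ 2 := by
      calc Real.exp (-C) * (s ^ 2 * c₁ ^ 2 / 64) / x ^ 18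
          = Real.exp (-C) * (s * (c₁ * (1 / (2 * x ^ 3)) ^ 3)) ^ 2 := by field_simp; norm_num
        _ ≤ Real.exp (x ^ 6 * ρ t) * (s * |ψ t|) ^ 2 := by gcongr
        _ = _ := by rw [mul_pow, sq_abs, mul_pow]
    linarith
  · intro t ht
    have h1 := H.exp_tail_le hbpos hx0 ht.1 ht.2
    have h2 := neg_two_mul_le (Real.exp (x ^ 6 * ρ t)) (s * ψ t) (d * ψ t)
      (Real.exp_pos _).le
    have h3 : L / x ^ 24 = 2 * ((12).factorial / (c * b ^ 2) ^ 12 / x ^ 24) := by rw [hL]; ring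
    rw [h3]
    linarith

end PhaseBounds

section BernoulliPhase

/-- Squared modulus of the characteristic function `1 - p + p e^{it}`. -/
noncomputable def bernoulliNormSq (p t : ℝ) : ℝ := 1 - 2 * p * (1 - p) * (1 - Real.cos t)

/-- Log-modulus of the characteristic function `1 - p + p e^{it}`. -/
noncomputable def bernoulliLogNorm (p t : ℝ) : ℝ := Real.log (bernoulliNormSq p t) / 2

/-- Phase of the characteristic function `1 - p + p e^{it}`, minus its linear part `p t`. -/
noncomputable def bernoulliPhase (p t : ℝ) : ℝ :=
  -(p * (1 - p) * (1 - 2 * p)) * ∫ u in (0 : ℝ)..t, (1 - Real.cos u) / bernoulliNormSq p u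

variable {p : ℝ}

theorem sq_le_bernoulliNormSq (h0 : 0 < p) (h1 : p < 1) (t : ℝ) :
    (1 - 2 * p) ^ 2 ≤ bernoulliNormSq p t := by
  unfold bernoulliNormSq
  nlinarith [Real.neg_one_le_cos t, mul_pos h0 (sub_pos.2 h1)]

theorem bernoulliNormSq_le_one (h0 : 0 < p) (h1 : p < 1) (t : ℝ) : bernoulliNormSq p t ≤ 1 := by
  unfold bernoulliNormSq
  nlinarith [Real.cos_le_one t, mul_pos h0 (sub_pos.2 h1)]

theorem sq_one_sub_two_mul_pos (hp : p ≠ 1 / 2) : 0 < (1 - 2 * p) ^ 2 := by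
  have : 1 - 2 * p ≠ 0 := fun h => hp (by linarith)
  positivity

theorem bernoulliNormSq_pos (h0 : 0 < p) (h1 : p < 1) (hp : p ≠ 1 / 2) (t : ℝ) :
    0 < bernoulliNormSq p t :=
  (sq_one_sub_two_mul_pos hp).trans_le (sq_le_bernoulliNormSq h0 h1 t)

theorem continuous_bernoulliNormSq : Continuous (bernoulliNormSq p) := by
  unfold bernoulliNormSq; fun_prop

theorem hasDerivAt_bernoulliNormSq (t : ℝ) :
    HasDerivAt (bernoulliNormSq p) (-(2 * p * (1 - p) * Real.sin t)) t := by
  have h := (((Real.hasDerivAt_cos t).const_sub 1).const_mul (2 * p * (1 - p))).const_sub 1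
  exact h.congr_deriv (by ring)

theorem continuous_phase_density (h0 : 0 < p) (h1 : p < 1) (hp : p ≠ 1 / 2) :
    Continuous fun u => (1 - Real.cos u) / bernoulliNormSq p u :=
  (continuous_const.sub Real.continuous_cos).div continuous_bernoulliNormSq
    fun t => (bernoulliNormSq_pos h0 h1 hp t).ne'

theorem hasDerivAt_bernoulliPhase (h0 : 0 < p) (h1 : p < 1) (hp : p ≠ 1 / 2) (t : ℝ) :
    HasDerivAt (bernoulliPhase p)
      (-(p * (1 - p) * (1 - 2 * p)) * ((1 - Real.cos t) / bernoulliNormSq p t)) t :=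
  ((continuous_phase_density h0 h1 hp).integral_hasStrictDerivAt 0 t).hasDerivAt.const_mul _

theorem hasDerivAt_bernoulliLogNorm (h0 : 0 < p) (h1 : p < 1) (hp : p ≠ 1 / 2) (t : ℝ) :
    HasDerivAt (bernoulliLogNorm p)
      (-(2 * p * (1 - p) * Real.sin t) / bernoulliNormSq p t / 2) t :=
  ((hasDerivAt_bernoulliNormSq t).log (bernoulliNormSq_pos h0 h1 hp t).ne').div_const 2

/-- Polar form of the characteristic function of a Bernoulli variable. -/
theorem bernoulli_charFun_eq (h0 : 0 < p) (h1 : p < 1) (hp : p ≠ 1 / 2) (t : ℝ) :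
    (1 - p + p * Complex.exp (t * Complex.I) : ℂ) =
      Complex.exp (bernoulliLogNorm p t + (p * t + bernoulliPhase p t : ℝ) * Complex.I) := by
  set L : ℝ → ℂ := fun t =>
    bernoulliLogNorm p t + (p * t + bernoulliPhase p t : ℝ) * Complex.I with hL
  set G : ℝ → ℂ := fun t => (1 - p + p * Complex.exp (t * Complex.I)) * Complex.exp (-L t) with hG
  have hd : ∀ t, HasDerivAt G 0 t := by
    intro t
    have e1 : HasDerivAt (fun t : ℝ => (1 - p + p * Complex.exp (t * Complex.I) : ℂ))
        (p * (Complex.exp (t * Complex.I) * (1 * Complex.I))) t :=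
      (((Complex.ofRealCLM.hasDerivAt (x := t)).mul_const Complex.I).cexp.const_mul (p : ℂ)).const_add
        (1 - p : ℂ)
    have e2 := (hasDerivAt_bernoulliLogNorm h0 h1 hp t).ofReal_comp
    have e3 := ((((hasDerivAt_id t).const_mul p).add
      (hasDerivAt_bernoulliPhase h0 h1 hp t)).ofReal_comp).mul_const Complex.I
    have e4 := e1.mul (e2.add e3).neg.cexp
    refine e4.congr_deriv ?_
    have hne : (bernoulliNormSq p t : ℂ) ≠ 0 :=
      Complex.ofReal_ne_zero.2 (bernoulliNormSq_pos h0 h1 hp t).ne'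
    have hcs : (Complex.sin t) ^ 2 + (Complex.cos t) ^ 2 = 1 := Complex.sin_sq_add_cos_sq _
    have hR : (bernoulliNormSq p t : ℂ) = 1 - 2 * p * (1 - p) * (1 - Complex.cos t) := by
      unfold bernoulliNormSq; push_cast; ring
    have key : (p * (Complex.exp (t * Complex.I) * (1 * Complex.I)) : ℂ) =
        (1 - p + p * Complex.exp (t * Complex.I)) *
        (((-(2 * p * (1 - p) * Real.sin t) / bernoulliNormSq p t / 2 : ℝ) : ℂ) +
        ((p * 1 + -(p * (1 - p) * (1 - 2 * p)) * ((1 - Real.cos t) / bernoulliNormSq p t) : ℝ) : ℂ)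
          * Complex.I) := by
      rw [Complex.exp_mul_I]
      push_cast
      field_simp
      rw [hR]
      linear_combination (p * Complex.sin t * (1 - 2 * p * (1 - p) * (1 - Complex.cos t) -
        p * (p + (1 - p) * Complex.cos t)) : ℂ) * Complex.I_sq +
        (Complex.I * p ^ 2 * (1 - p) : ℂ) * hcs
    rw [key]
    ring
  have hconst : G t = G 0 := is_const_of_deriv_eq_zero (fun t => (hd t).differentiableAt)
    (fun t => (hd t).deriv) t 0
  have hG0 : G 0 = 1 := by
    simp [hG, hL, bernoulliLogNorm, bernoulliPhase, bernoulliNormSq]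
  rw [hG0] at hconst
  have : G t * Complex.exp (L t) = 1 - p + p * Complex.exp (t * Complex.I) := by
    simp only [hG]
    rw [mul_assoc, ← Complex.exp_add]; simp
  rw [← this, hconst, one_mul]

theorem integral_phase_density_bounds (h0 : 0 < p) (h1 : p < 1) (hp : p ≠ 1 / 2) {t : ℝ}
    (ht : t ∈ Set.Icc 0 Real.pi) :
    2 / Real.pi ^ 2 / 3 * t ^ 3 ≤ ∫ u in (0 : ℝ)..t, (1 - Real.cos u) / bernoulliNormSq p u ∧
      ∫ u in (0 : ℝ)..t, (1 - Real.cos u) / bernoulliNormSq p u ≤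
        1 / (1 - 2 * p) ^ 2 / 6 * t ^ 3 := by
  have hpos := sq_one_sub_two_mul_pos hp
  have hi := (continuous_phase_density h0 h1 hp).intervalIntegrable (μ := MeasureTheory.volume) 0 t
  constructor
  · have := intervalIntegral.integral_mono_on (f := fun u => 2 / Real.pi ^ 2 * u ^ 2) ht.1
      (by apply Continuous.intervalIntegrable; fun_prop) hi (fun u hu => by
        have hR := bernoulliNormSq_pos h0 h1 hp u
        rw [le_div_iff₀ hR]
        have hc := Real.cos_le_one_sub_mul_cos_sq (x := u)
          (abs_le.2 ⟨by linarith [hu.1, Real.pi_pos], hu.2.trans ht.2⟩)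
        calc 2 / Real.pi ^ 2 * u ^ 2 * bernoulliNormSq p u ≤ 2 / Real.pi ^ 2 * u ^ 2 * 1 := by
              gcongr; exact bernoulliNormSq_le_one h0 h1 u
          _ ≤ 1 - Real.cos u := by linarith)
    refine le_trans (le_of_eq ?_) this
    rw [intervalIntegral.integral_const_mul, integral_pow]
    norm_num; ring
  · have := intervalIntegral.integral_mono_on (g := fun u => 1 / (1 - 2 * p) ^ 2 / 2 * u ^ 2) ht.1
      hi (by apply Continuous.intervalIntegrable; fun_prop) (fun u hu => by
        calc (1 - Real.cos u) / bernoulliNormSq p u ≤ (u ^ 2 / 2) / (1 - 2 * p) ^ 2 := by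
              gcongr
              · exact one_sub_cos_le_sq_div_two u
              · exact sq_le_bernoulliNormSq h0 h1 u
          _ = _ := by ring)
    refine this.trans (le_of_eq ?_)
    rw [intervalIntegral.integral_const_mul, integral_pow]
    norm_num; ring

theorem bernoulli_phaseBounds (h0 : 0 < p) (h1 : p < 1) (hp : p ≠ 1 / 2) :
    PhaseBounds (bernoulliLogNorm p) (bernoulliPhase p) (p * (1 - p) * (2 / Real.pi ^ 2))
      (p * (1 - p) / (1 - 2 * p) ^ 2 / 2) (|p * (1 - p) * (1 - 2 * p)| * (2 / Real.pi ^ 2 / 3))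
      (|p * (1 - p) * (1 - 2 * p)| * (1 / (1 - 2 * p) ^ 2 / 6)) := by
  have hpos := sq_one_sub_two_mul_pos hp
  have hpq : 0 < p * (1 - p) := mul_pos h0 (sub_pos.2 h1)
  have hκ : 0 < |p * (1 - p) * (1 - 2 * p)| :=
    abs_pos.2 (mul_ne_zero hpq.ne' fun h => hp (by linarith))
  have hpi := Real.pi_pos
  have habs : ∀ t ∈ Set.Icc 0 Real.pi, |bernoulliPhase p t| = |p * (1 - p) * (1 - 2 * p)| *
      ∫ u in (0 : ℝ)..t, (1 - Real.cos u) / bernoulliNormSq p u := by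
    intro t ht
    have hn : 0 ≤ ∫ u in (0 : ℝ)..t, (1 - Real.cos u) / bernoulliNormSq p u := by
      have := ht.1
      exact le_trans (by positivity) (integral_phase_density_bounds h0 h1 hp ht).1
    rw [bernoulliPhase, abs_mul, abs_neg, abs_of_nonneg hn]
  refine ⟨?_, ?_, by positivity, by positivity, by positivity, by positivity, ?_, ?_, ?_, ?_⟩
  · exact continuous_iff_continuousAt.2 fun t =>
      (hasDerivAt_bernoulliLogNorm h0 h1 hp t).continuousAt
  · exact continuous_iff_continuousAt.2 fun t =>
      (hasDerivAt_bernoulliPhase h0 h1 hp t).continuousAt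
  · intro t ht
    have h2 := Real.log_le_sub_one_of_pos (bernoulliNormSq_pos h0 h1 hp t)
    have hc := Real.cos_le_one_sub_mul_cos_sq (x := t)
      (abs_le.2 ⟨by linarith [ht.1, Real.pi_pos], ht.2⟩)
    have h3 : p * (1 - p) * (2 / Real.pi ^ 2 * t ^ 2) ≤ p * (1 - p) * (1 - Real.cos t) := by
      gcongr; linarith
    unfold bernoulliLogNorm
    unfold bernoulliNormSq at h2 ⊢
    linarith
  · intro t ht
    have hR := bernoulliNormSq_pos h0 h1 hp t
    have h2 := Real.one_sub_inv_le_log_of_pos hR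
    have h3 : (bernoulliNormSq p t)⁻¹ - 1 ≤ p * (1 - p) / (1 - 2 * p) ^ 2 * t ^ 2 := by
      calc (bernoulliNormSq p t)⁻¹ - 1 = 2 * (p * (1 - p)) * (1 - Real.cos t) /
            bernoulliNormSq p t := by
            field_simp; unfold bernoulliNormSq; ring
        _ ≤ 2 * (p * (1 - p)) * (t ^ 2 / 2) / (1 - 2 * p) ^ 2 := by
            gcongr
            · exact one_sub_cos_le_sq_div_two t
            · exact sq_le_bernoulliNormSq h0 h1 t
        _ = _ := by ring
    unfold bernoulliLogNorm
    linarith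
  · intro t ht
    rw [habs t ht, mul_assoc |p * (1 - p) * (1 - 2 * p)|]
    gcongr
    exact (integral_phase_density_bounds h0 h1 hp ht).2
  · intro t ht
    rw [habs t ht, mul_assoc |p * (1 - p) * (1 - 2 * p)|]
    gcongr
    exact (integral_phase_density_bounds h0 h1 hp ht).1

end BernoulliPhase

section Fourier

theorem integral_cos_int_mul (z : ℤ) :
    ∫ t in (0 : ℝ)..Real.pi, Real.cos (z * t) = if z = 0 then Real.pi else 0 := by
  split_ifs with h
  · simp [h]
  · have hz : (z : ℝ) ≠ 0 := Int.cast_ne_zero.2 h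
    rw [intervalIntegral.integral_comp_mul_left (fun u => Real.cos u) hz]
    simp [Real.sin_int_mul_pi]

variable {p : ℝ}

theorem exp_mul_cos_eq_sum (h0 : 0 < p) (h1 : p < 1) (hp : p ≠ 1 / 2) (ℓ m : ℕ) (y : ℤ) (t : ℝ) :
    Real.exp ((ℓ + m) * bernoulliLogNorm p t) *
        Real.cos ((ℓ - m) * bernoulliPhase p t - (y - (ℓ - m) * p) * t) =
      ∑ k ∈ Finset.range (ℓ + 1), ∑ j ∈ Finset.range (m + 1),
        (ℓ.choose k : ℝ) * (m.choose j : ℝ) * p ^ (k + j) * (1 - p) ^ ((ℓ - k) + (m - j)) *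
          Real.cos (((k - j - y : ℤ) : ℝ) * t) := by
  have hφ := bernoulli_charFun_eq h0 h1 hp t
  have hφ' : (1 - p + p * Complex.exp (-(t * Complex.I)) : ℂ) =
      Complex.exp (bernoulliLogNorm p t - (p * t + bernoulliPhase p t : ℝ) * Complex.I) := by
    have := congrArg (starRingEnd ℂ) hφ
    simpa [← Complex.exp_conj, sub_eq_add_neg] using this
  have hlhs : (1 - p + p * Complex.exp (t * Complex.I) : ℂ) ^ ℓ *
      (1 - p + p * Complex.exp (-(t * Complex.I)) : ℂ) ^ m * Complex.exp (-(y * t * Complex.I)) =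
      Complex.exp (((ℓ + m) * bernoulliLogNorm p t : ℝ) +
        ((ℓ - m) * bernoulliPhase p t - (y - (ℓ - m) * p) * t : ℝ) * Complex.I) := by
    rw [hφ, hφ', ← Complex.exp_nat_mul, ← Complex.exp_nat_mul, ← Complex.exp_add, ← Complex.exp_add]
    congr 1
    push_cast
    ring
  have hrhs : (1 - p + p * Complex.exp (t * Complex.I) : ℂ) ^ ℓ *
      (1 - p + p * Complex.exp (-(t * Complex.I)) : ℂ) ^ m * Complex.exp (-(y * t * Complex.I)) =
      ∑ k ∈ Finset.range (ℓ + 1), ∑ j ∈ Finset.range (m + 1),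
        (((ℓ.choose k : ℝ) * (m.choose j : ℝ) * p ^ (k + j) * (1 - p) ^ ((ℓ - k) + (m - j)) : ℝ) : ℂ)
          * Complex.exp ((((k - j - y : ℤ) : ℝ) * t : ℝ) * Complex.I) := by
    rw [add_comm (1 - p : ℂ), add_comm (1 - p : ℂ), add_pow, add_pow, Finset.sum_mul_sum,
      Finset.sum_mul]
    refine Finset.sum_congr rfl fun k _ => ?_
    rw [Finset.sum_mul]
    refine Finset.sum_congr rfl fun j _ => ?_
    have he : Complex.exp ((((k - j - y : ℤ) : ℝ) * t : ℝ) * Complex.I) =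
        Complex.exp (t * Complex.I) ^ k * Complex.exp (-(t * Complex.I)) ^ j *
          Complex.exp (-(y * t * Complex.I)) := by
      rw [← Complex.exp_nat_mul, ← Complex.exp_nat_mul, ← Complex.exp_add, ← Complex.exp_add]
      congr 1
      push_cast
      ring
    rw [he]
    push_cast
    ring
  have h := congrArg Complex.re (hlhs.symm.trans hrhs)
  rw [Complex.exp_add, ← Complex.ofReal_exp, Complex.re_ofReal_mul, Complex.exp_ofReal_mul_I_re,
    Complex.re_sum] at h
  rw [h]
  refine Finset.sum_congr rfl fun k _ => ?_
  rw [Complex.re_sum]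
  refine Finset.sum_congr rfl fun j _ => ?_
  rw [Complex.re_ofReal_mul, Complex.exp_ofReal_mul_I_re]

/-- Fourier inversion for the difference of two binomials. -/
theorem integral_eq_pi_mul_D (h0 : 0 < p) (h1 : p < 1) (hp : p ≠ 1 / 2) (ℓ m : ℕ) (y : ℤ) :
    ∫ t in (0 : ℝ)..Real.pi, Real.exp ((ℓ + m) * bernoulliLogNorm p t) *
        Real.cos ((ℓ - m) * bernoulliPhase p t - (y - (ℓ - m) * p) * t) =
      Real.pi * D ℓ m p y := by
  simp_rw [exp_mul_cos_eq_sum h0 h1 hp]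
  rw [intervalIntegral.integral_finsetSum
    fun k _ => by apply Continuous.intervalIntegrable; fun_prop, D, Finset.mul_sum]
  refine Finset.sum_congr rfl fun k _ => ?_
  rw [intervalIntegral.integral_finsetSum
    fun j _ => by apply Continuous.intervalIntegrable; fun_prop, Finset.mul_sum]
  refine Finset.sum_congr rfl fun j _ => ?_
  rw [intervalIntegral.integral_const_mul, integral_cos_int_mul]
  simp only [sub_eq_zero, mul_ite, mul_zero]
  split_ifs <;> ring

theorem D_nonneg (h0 : 0 ≤ p) (h1 : p ≤ 1) (ℓ m : ℕ) (y : ℤ) : 0 ≤ D ℓ m p y := by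
  have : 0 ≤ 1 - p := by linarith
  refine Finset.sum_nonneg fun k _ => Finset.sum_nonneg fun j _ => ?_
  split_ifs <;> positivity

theorem D_eq_zero_of_lt_abs {ℓ m : ℕ} {y : ℤ} (h : ((ℓ + m : ℕ) : ℤ) < |y|) : D ℓ m p y = 0 := by
  refine Finset.sum_eq_zero fun k hk => Finset.sum_eq_zero fun j hj => if_neg ?_
  rw [Finset.mem_range] at hk hj
  rcases lt_abs.1 h with h | h <;> omega

end Fourier

/-- for `p = r/s` with `s` odd, for all sufficiently large odd `n`,
the concentration probability over ±1 signings is maximized by taking `(n+s)/2`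
coefficients equal to `1`, at the point `x = r`. -/
theorem stmt_11 (r s : ℕ) (hr : 0 < r) (hs : 0 < s) (hco : Nat.Coprime r s)
    (hsodd : Odd s) (hrs : r < s) :
    ∃ N : ℕ, ∀ n : ℕ, N ≤ n → Odd n → ∀ ℓ : ℕ, ℓ ≤ n → ∀ y : ℤ,
      D ℓ (n - ℓ) ((r : ℝ) / (s : ℝ)) y ≤
        D ((n + s) / 2) ((n - s) / 2) ((r : ℝ) / (s : ℝ)) (r : ℤ) := by
  have hs' : (0 : ℝ) < s := Nat.cast_pos.2 hs
  set p : ℝ := (r : ℝ) / s with hpdef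
  have h0 : 0 < p := by positivity
  have h1 : p < 1 := by rw [hpdef, div_lt_one hs']; exact_mod_cast hrs
  have hsp : s * p = r := by rw [hpdef]; field_simp
  have hp : p ≠ 1 / 2 := by
    intro h
    have h2 : (s : ℝ) = 2 * r := by rw [← hsp, h]; ring
    have h3 : s = 2 * r := by exact_mod_cast h2
    obtain ⟨a, ha⟩ := hsodd
    omega
  have H := bernoulli_phaseBounds h0 h1 hp
  obtain ⟨X₁, hX₁⟩ := H.integral_le_of_linear_term hs'
  obtain ⟨X₂, hX₂⟩ := H.integral_le_of_three_mul_le hs'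
  set X := max (max X₁ X₂) 1 with hX
  refine ⟨max s ⌈X ^ 6⌉₊, fun n hn hnodd ℓ hℓ y => ?_⟩
  obtain ⟨m, rfl⟩ := Nat.exists_eq_add_of_le hℓ
  rw [Nat.add_sub_cancel_left]
  by_cases hy : ((ℓ + m : ℕ) : ℤ) < |y|
  · rw [D_eq_zero_of_lt_abs hy]
    exact D_nonneg h0.le h1.le _ _ _
  push Not at hy
  have hsn : s ≤ ℓ + m := (le_max_left _ _).trans hn
  have hXn : X ^ 6 ≤ ((ℓ + m : ℕ) : ℝ) := Nat.ceil_le.1 ((le_max_right _ _).trans hn)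
  set x : ℝ := ((ℓ + m : ℕ) : ℝ) ^ (1 / 6 : ℝ) with hx
  have hx6 : x ^ 6 = (ℓ + m : ℝ) := by
    rw [hx, ← Real.rpow_natCast, ← Real.rpow_mul (by positivity)]
    norm_num
  have hx0 : 0 ≤ x := by positivity
  have hXx : X ≤ x := by
    refine le_of_pow_le_pow_left₀ (n := 6) (by norm_num) hx0 ?_
    rw [hx6]; exact_mod_cast hXn
  have hx₁ : X₁ ≤ x := ((le_max_left _ _).trans (le_max_left _ _)).trans hXx
  have hx₂ : X₂ ≤ x := ((le_max_right _ _).trans (le_max_left _ _)).trans hXx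
  have htarget : ∫ t in (0 : ℝ)..Real.pi, Real.exp (x ^ 6 * bernoulliLogNorm p t) *
      Real.cos (s * bernoulliPhase p t) =
      Real.pi * D ((ℓ + m + s) / 2) ((ℓ + m - s) / 2) p r := by
    rw [← integral_eq_pi_mul_D h0 h1 hp]
    obtain ⟨a, ha⟩ := hnodd
    obtain ⟨c, hc⟩ := hsodd
    have e1 : (ℓ + m + s) / 2 + (ℓ + m - s) / 2 = ℓ + m := by omega
    have e2 : (ℓ + m + s) / 2 = s + (ℓ + m - s) / 2 := by omega
    have e1' : (((ℓ + m + s) / 2 : ℕ) : ℝ) + ((ℓ + m - s) / 2 : ℕ) = x ^ 6 := by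
      rw [hx6]; exact_mod_cast e1
    have e2' : (((ℓ + m + s) / 2 : ℕ) : ℝ) - ((ℓ + m - s) / 2 : ℕ) = s := by
      rw [e2]; push_cast; ring
    rw [e1', e2', hsp]
    simp
  refine le_of_mul_le_mul_left ?_ Real.pi_pos
  rw [← htarget, ← integral_eq_pi_mul_D h0 h1 hp, ← hx6]
  have hℓ0 : (0 : ℝ) ≤ ℓ := Nat.cast_nonneg ℓ
  have hm0 : (0 : ℝ) ≤ m := Nat.cast_nonneg m
  have hd : |(ℓ - m : ℝ)| ≤ x ^ 6 := by
    rw [hx6, abs_le]; constructor <;> linarith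
  have hyx : |(y : ℝ)| ≤ x ^ 6 := by
    rw [hx6]; exact_mod_cast hy
  have hδs : (y - (ℓ - m) * p : ℝ) = ((y * s - (ℓ - m) * r : ℤ) : ℝ) / s := by
    rw [eq_div_iff hs'.ne']
    push_cast
    rw [← hsp]; ring
  by_cases hz : (y * s - (ℓ - m) * r : ℤ) = 0
  · have hδ : (y - (ℓ - m) * p : ℝ) = 0 := by rw [hδs, hz]; simp
    simp only [hδ, zero_mul, sub_zero]
    have hdvd : (s : ℤ) ∣ (ℓ - m : ℤ) := by
      have h2 : (s : ℤ) ∣ (ℓ - m : ℤ) * r := ⟨y, by linarith⟩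
      exact (Nat.isCoprime_iff_coprime.2 hco).symm.dvd_of_dvd_mul_right h2
    obtain ⟨k, hk⟩ := hdvd
    have hkR : (ℓ - m : ℝ) = s * k := by exact_mod_cast hk
    have hkodd : Odd k := by
      have h2 : Odd (ℓ - m : ℤ) := by
        obtain ⟨a, ha⟩ := hnodd
        exact ⟨a - m, by omega⟩
      rw [hk] at h2
      exact (Int.odd_mul.1 h2).2
    by_cases hk3 : 3 ≤ |k|
    · refine hX₂ x hx₂ _ hd ?_
      rw [hkR, abs_mul, abs_of_pos hs', mul_comm]
      gcongr
      exact_mod_cast hk3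
    · have hk1 : k = 1 ∨ k = -1 := by
        obtain ⟨a, ha⟩ := hkodd
        rw [not_le, abs_lt] at hk3
        omega
      rcases hk1 with h | h
      · rw [hkR, h]; simp
      · rw [hkR, h]; simp
  · refine hX₁ x hx₁ _ _ hd ?_ ?_
    · rw [hδs, abs_div, abs_of_pos hs']
      gcongr
      exact_mod_cast Int.one_le_abs hz
    · calc |(y - (ℓ - m) * p : ℝ)| ≤ |(y : ℝ)| + |(ℓ - m) * p| := abs_sub _ _
        _ = |(y : ℝ)| + |(ℓ - m : ℝ)| * p := by rw [abs_mul, abs_of_pos h0]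
        _ ≤ x ^ 6 + x ^ 6 * 1 := by gcongr
        _ = 2 * x ^ 6 := by ring
end
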